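/- arXiv:2406.13036 — 2 statements merged into one kernel-verified Lean document; each statement's English description precedes it below -/
import Mathlib

section
/- Dimensional Euclidean logarithmic Sobolev inequality (Dembo's form): for any smooth probability density f on R^d with finite Fisher information matrix J(f) = ∫ (∇f)(∇f)^T / f dx, one has ∫ f ln f dx ≤ (1/2) ln det(J(f)) − (d/2) ln(2πe). -/
open Matrix MeasureTheory

/-- The `i`-th partial derivative of `f` at `x`. -/
noncomputable def pder (d : ℕ) (f : (Fin d → ℝ) → ℝ) (i : Fin d) (x : Fin d → ℝ) : ℝ :=
  fderiv ℝ f x (Pi.single i 1)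

/-- The Fisher information matrix `J(f) = ∫ (∇f)(∇f)ᵀ / f dx` of a density `f`. -/
noncomputable def fisherMat (d : ℕ) (f : (Fin d → ℝ) → ℝ) : Matrix (Fin d) (Fin d) ℝ :=
  Matrix.of fun i j => ∫ x : Fin d → ℝ, pder d f i x * pder d f j x / f x

open Filter Topology Set

noncomputable def cdfOf (m : ℝ → ℝ) (x : ℝ) : ℝ := ∫ t in Iic x, m t

lemma cdfOf_sub {m : ℝ → ℝ} (hi : Integrable m) (a b : ℝ) :
    cdfOf m b - cdfOf m a = ∫ t in a..b, m t :=
  intervalIntegral.integral_Iic_sub_Iic hi.integrableOn hi.integrableOn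

lemma cdfOf_hasDerivAt {m : ℝ → ℝ} (hc : Continuous m) (hi : Integrable m) (x : ℝ) :
    HasDerivAt (cdfOf m) (m x) x := by
  have h1 : HasDerivAt (fun b => ∫ t in x..b, m t) (m x) x :=
    intervalIntegral.integral_hasDerivAt_right (hi.intervalIntegrable)
      hc.stronglyMeasurable.stronglyMeasurableAtFilter hc.continuousAt
  have h2 : cdfOf m = fun b => (∫ t in x..b, m t) + cdfOf m x := by
    ext b; rw [← cdfOf_sub hi]; ring
  rw [h2]; exact h1.add_const _

lemma cdfOf_pos {m : ℝ → ℝ} (hi : Integrable m) (h0 : ∀ᵐ x, 0 < m x) (x : ℝ) :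
    0 < cdfOf m x := by
  unfold cdfOf
  have h0' : ∀ᵐ y ∂(volume.restrict (Iic x)), 0 < m y := ae_restrict_of_ae h0
  rw [integral_pos_iff_support_of_nonneg_ae (h0'.mono fun y hy => hy.le) hi.integrableOn]
  have : Function.support m =ᵐ[volume.restrict (Iic x)] (univ : Set ℝ) := by
    rw [eventuallyEq_univ]
    filter_upwards [h0'] with y hy using hy.ne'
  rw [measure_congr this]; simp

lemma cdfOf_lt {m : ℝ → ℝ} (hi : Integrable m) (h0 : ∀ᵐ x, 0 < m x) (x : ℝ) :
    cdfOf m x < ∫ t, m t := by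
  have h0' : ∀ᵐ y ∂(volume.restrict (Ioi x)), 0 < m y := ae_restrict_of_ae h0
  have h1 : 0 < ∫ t in Ioi x, m t := by
    rw [integral_pos_iff_support_of_nonneg_ae (h0'.mono fun y hy => hy.le) hi.integrableOn]
    have : Function.support m =ᵐ[volume.restrict (Ioi x)] (univ : Set ℝ) := by
      rw [eventuallyEq_univ]
      filter_upwards [h0'] with y hy using hy.ne'
    rw [measure_congr this]; simp
  have := intervalIntegral.integral_Iic_add_Ioi (b := x) hi.integrableOn hi.integrableOn
  unfold cdfOf; linarith

lemma cdfOf_atTop {m : ℝ → ℝ} (hi : Integrable m) :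
    Tendsto (cdfOf m) atTop (𝓝 (∫ t, m t)) :=
  (aecover_Iic tendsto_id).integral_tendsto_of_countably_generated hi

lemma cdfOf_atBot {m : ℝ → ℝ} (hi : Integrable m) :
    Tendsto (cdfOf m) atBot (𝓝 0) := by
  have h1 : Tendsto (fun x => ∫ t in Ioi x, m t) atBot (𝓝 (∫ t, m t)) :=
    (aecover_Ioi tendsto_id).integral_tendsto_of_countably_generated hi
  have h2 : cdfOf m = fun x => (∫ t, m t) - ∫ t in Ioi x, m t := by
    ext x
    have := intervalIntegral.integral_Iic_add_Ioi (b := x) (f := m) hi.integrableOn hi.integrableOn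
    unfold cdfOf; linarith
  rw [h2]; simpa using h1.const_sub (∫ t, m t)

noncomputable def gpdf (t : ℝ) : ℝ := (√(2 * Real.pi))⁻¹ * Real.exp (-t ^ 2 / 2)

lemma gpdf_pos (t : ℝ) : 0 < gpdf t := by unfold gpdf; positivity

lemma gpdf_cont : Continuous gpdf := by unfold gpdf; fun_prop

lemma gpdf_eq : gpdf = ProbabilityTheory.gaussianPDFReal 0 1 := by
  ext t; simp [gpdf, ProbabilityTheory.gaussianPDFReal]

lemma gpdf_int : Integrable gpdf := by
  rw [gpdf_eq]; exact ProbabilityTheory.integrable_gaussianPDFReal 0 1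

lemma gpdf_integral : ∫ t, gpdf t = 1 := by
  rw [gpdf_eq]; exact ProbabilityTheory.integral_gaussianPDFReal_eq_one 0 (by simp)

lemma gpdf_deriv (t : ℝ) : HasDerivAt gpdf (-t * gpdf t) t := by
  unfold gpdf
  have h : HasDerivAt (fun t : ℝ => -t ^ 2 / 2) (-t) t := by
    have := ((hasDerivAt_pow 2 t).neg).div_const 2
    exact this.congr_deriv (by push_cast; ring)
  exact (h.exp.const_mul (√(2 * Real.pi))⁻¹).congr_deriv (by ring)

lemma gpdf_log (t : ℝ) : Real.log (gpdf t) = -(1/2) * Real.log (2 * Real.pi) - t ^ 2 / 2 := by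
  unfold gpdf
  rw [Real.log_mul (by positivity) (by positivity), Real.log_exp, Real.log_inv,
    Real.log_sqrt (by positivity)]; ring

lemma exists_transport {m : ℝ → ℝ} (hc : Continuous m) (hi : Integrable m)
    (h0 : ∀ᵐ x, 0 < m x) (h1 : ∫ t, m t = 1) :
    ∃ T : ℝ → ℝ, ∀ x, HasDerivAt T (m x / gpdf (T x)) x := by
  have hg0 : ∀ᵐ x, 0 < gpdf x := Eventually.of_forall gpdf_pos
  have hΦ := cdfOf_hasDerivAt gpdf_cont gpdf_int
  have hΦc : Continuous (cdfOf gpdf) :=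
    continuous_iff_continuousAt.2 fun x => (hΦ x).continuousAt
  have hmono : StrictMono (cdfOf gpdf) := strictMono_of_deriv_pos fun x => by
    rw [(hΦ x).deriv]; exact gpdf_pos x
  have hF := cdfOf_hasDerivAt hc hi
  have hsurj : ∀ x, ∃ t, cdfOf gpdf t = cdfOf m x := fun x => by
    have := mem_range_of_exists_le_of_exists_ge hΦc (c := cdfOf m x)
      (((cdfOf_atBot gpdf_int).eventually_lt_const (cdfOf_pos hi h0 x)).exists.imp
        fun _ h => h.le)
      (((cdfOf_atTop gpdf_int).eventually_const_lt
        (by rw [gpdf_integral, ← h1]; exact cdfOf_lt hi h0 x)).exists.imp fun _ h => h.le)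
    exact this
  choose T hT using hsurj
  have hemb : IsEmbedding (cdfOf gpdf) :=
    hmono.isEmbedding_of_ordConnected (isPreconnected_range hΦc).ordConnected
  have hTc : Continuous T := by
    rw [hemb.continuous_iff]
    have : cdfOf gpdf ∘ T = cdfOf m := funext hT
    rw [this]
    exact continuous_iff_continuousAt.2 fun x => (hF x).continuousAt
  refine ⟨T, fun x => ?_⟩
  exact HasDerivAt.of_comp_left hTc.continuousAt (hΦ (T x)) (hF x) (gpdf_pos _).ne'
    (Eventually.of_forall hT)

/-- Truncated one-dimensional inequality. -/
lemma lsi_trunc {m h T : ℝ → ℝ} (hmc : Continuous m)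
    (hmpos : ∀ᵐ x, 0 < m x) (hh : Integrable h)
    (hac : ∀ a b, m b - m a = ∫ x in a..b, h x)
    (hJ : Integrable (fun x => h x ^ 2 / m x))
    (hE : Integrable (fun x => m x * Real.log (m x)))
    (hT : ∀ x, HasDerivAt T (m x / gpdf (T x)) x) {a b : ℝ} (hab : a ≤ b) :
    (∫ x in a..b, m x * Real.log (m x)) ≤
      (1/2) * (∫ x in a..b, h x ^ 2 / m x) - (1 + (1/2) * Real.log (2 * Real.pi)) *
        (∫ x in a..b, m x) + (m b * T b - m a * T a) := by
  have hTc : Continuous T := continuous_iff_continuousAt.2 fun x => (hT x).continuousAt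
  have hT'c : Continuous (fun x => m x / gpdf (T x)) :=
    hmc.div (gpdf_cont.comp hTc) fun x => (gpdf_pos _).ne'
  have hderiv : deriv T = fun x => m x / gpdf (T x) := funext fun x => (hT x).deriv
  have hTC1 : ContDiff ℝ 1 T := by
    rw [contDiff_one_iff_deriv]
    exact ⟨fun x => (hT x).differentiableAt, hderiv ▸ hT'c⟩
  have hTac : AbsolutelyContinuousOnInterval T a b :=
    hTC1.contDiffOn.absolutelyContinuousOnInterval
  have hmeq : m = fun x => m a + ∫ t in a..x, h t := by
    ext x; rw [← hac]; ring
  have hmac : AbsolutelyContinuousOnInterval m a b := by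
    rw [hmeq]
    have h1 : AbsolutelyContinuousOnInterval (fun x => ∫ t in a..x, h t) a b :=
      (hh.intervalIntegrable (a := a) (b := b)).absolutelyContinuousOnInterval_intervalIntegral
        (c := a) (by simp)
    have h2 : AbsolutelyContinuousOnInterval (fun _ : ℝ => m a) a b :=
      (contDiff_const (n := 1)).contDiffOn.absolutelyContinuousOnInterval
    exact h2.add h1
  have hdm : ∀ᵐ x, deriv m x = h x := by
    filter_upwards [_root_.LocallyIntegrable.ae_hasDerivAt_integral hh.locallyIntegrable] with x hx
    rw [hmeq]
    exact ((hx a).const_add (m a)).deriv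
  have ibp := hmac.integral_mul_deriv_eq_deriv_mul hTac
  rw [hderiv] at ibp
  have ibp2 : ∫ x in a..b, deriv m x * T x = ∫ x in a..b, h x * T x :=
    intervalIntegral.integral_congr_ae (hdm.mono fun x hx _ => by rw [hx])
  rw [ibp2] at ibp
  have ihT : IntervalIntegrable (fun x => h x * T x) volume a b :=
    (hh.intervalIntegrable).mul_continuousOn hTc.continuousOn
  have imT' : IntervalIntegrable (fun x => m x * (m x / gpdf (T x))) volume a b :=
    (hmc.mul hT'c).intervalIntegrable _ _
  have im : IntervalIntegrable m volume a b := hmc.intervalIntegrable _ _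
  have iJ : IntervalIntegrable (fun x => h x ^ 2 / m x) volume a b := hJ.intervalIntegrable
  have key : (∫ x in a..b, m x * Real.log (m x)) ≤
      ∫ x in a..b, ((1/2) * (h x ^ 2 / m x) - (1 + (1/2) * Real.log (2 * Real.pi)) * m x
        + (h x * T x + m x * (m x / gpdf (T x)))) := by
    apply intervalIntegral.integral_mono_ae hab hE.intervalIntegrable
      (((iJ.const_mul _).sub (im.const_mul _)).add (ihT.add imT'))
    filter_upwards [hmpos] with x hx
    have hg := gpdf_pos (T x)
    have e1 : Real.log (m x) = Real.log (gpdf (T x)) + Real.log (m x / gpdf (T x)) := by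
      rw [Real.log_div hx.ne' hg.ne']; ring
    have e2 : Real.log (m x / gpdf (T x)) ≤ m x / gpdf (T x) - 1 :=
      Real.log_le_sub_one_of_pos (by positivity)
    have e3 : 0 ≤ (1/2) * (h x ^ 2 / m x) + h x * T x + m x * (T x ^ 2 / 2) := by
      have : (1/2) * (h x ^ 2 / m x) + h x * T x + m x * (T x ^ 2 / 2)
        = (1/2) * (h x + m x * T x) ^ 2 / m x := by field_simp; ring
      rw [this]; positivity
    have e4 := mul_le_mul_of_nonneg_left e2 hx.le
    show m x * Real.log (m x) ≤ _
    rw [e1, gpdf_log, mul_add]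
    nlinarith
  rw [intervalIntegral.integral_add ((iJ.const_mul _).sub (im.const_mul _)) (ihT.add imT'),
    intervalIntegral.integral_sub (iJ.const_mul _) (im.const_mul _),
    intervalIntegral.integral_add ihT imT', intervalIntegral.integral_const_mul,
    intervalIntegral.integral_const_mul, ibp] at key
  linarith

lemma boundary_top {m T : ℝ → ℝ} (hT : ∀ x, HasDerivAt T (m x / gpdf (T x)) x)
    {ε : ℝ} (hε : 0 < ε) (B : ℝ) : ∃ b, B ≤ b ∧ m b * T b < ε := by
  by_contra! hcon
  have hd : ∀ x, HasDerivAt (fun x => gpdf (T x)) (-(m x * T x)) x := fun x =>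
    ((gpdf_deriv (T x)).comp x (hT x)).congr_deriv (by
      have := (gpdf_pos (T x)).ne'; field_simp)
  set R := gpdf (T B) / ε + 1
  have hR : 0 < R := by have := gpdf_pos (T B); positivity
  obtain ⟨c, hc, hc2⟩ := exists_hasDerivAt_eq_slope (fun x => gpdf (T x)) _
    (show B < B + R by linarith)
    (fun x _ => (hd x).continuousAt.continuousWithinAt) (fun x _ => hd x)
  have h1 := hcon c hc.1.le
  have h2 := gpdf_pos (T (B + R))
  rw [eq_div_iff (by linarith)] at hc2
  have h3 : ε * R = gpdf (T B) + ε := by simp only [R]; field_simp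
  nlinarith

lemma boundary_bot {m T : ℝ → ℝ} (hT : ∀ x, HasDerivAt T (m x / gpdf (T x)) x)
    {ε : ℝ} (hε : 0 < ε) (B : ℝ) : ∃ b, b ≤ B ∧ -(m b * T b) < ε := by
  by_contra! hcon
  have hd : ∀ x, HasDerivAt (fun x => gpdf (T x)) (-(m x * T x)) x := fun x =>
    ((gpdf_deriv (T x)).comp x (hT x)).congr_deriv (by
      have := (gpdf_pos (T x)).ne'; field_simp)
  set R := gpdf (T B) / ε + 1
  have hR : 0 < R := by have := gpdf_pos (T B); positivity
  obtain ⟨c, hc, hc2⟩ := exists_hasDerivAt_eq_slope (fun x => gpdf (T x)) _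
    (show B - R < B by linarith)
    (fun x _ => (hd x).continuousAt.continuousWithinAt) (fun x _ => hd x)
  have h1 := hcon c hc.2.le
  have h2 := gpdf_pos (T (B - R))
  rw [eq_div_iff (by linarith)] at hc2
  have h3 : ε * R = gpdf (T B) + ε := by simp only [R]; field_simp
  nlinarith

/-- One-dimensional Euclidean LSI for absolutely continuous densities. -/
lemma lsi_one {m h : ℝ → ℝ} (hmc : Continuous m)
    (hmpos : ∀ᵐ x, 0 < m x) (hmi : Integrable m) (hm1 : ∫ x, m x = 1) (hh : Integrable h)
    (hac : ∀ a b, m b - m a = ∫ x in a..b, h x)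
    (hJ : Integrable (fun x => h x ^ 2 / m x))
    (hE : Integrable (fun x => m x * Real.log (m x))) :
    (∫ x, m x * Real.log (m x)) ≤
      (1/2) * (∫ x, h x ^ 2 / m x) - (1 + (1/2) * Real.log (2 * Real.pi)) := by
  obtain ⟨T, hT⟩ := exists_transport hmc hmi hmpos hm1
  have hpos : ∀ n : ℕ, (0:ℝ) < 1 / ((n:ℝ) + 1) := fun n => by positivity
  choose b hb1 hb2 using fun n : ℕ => boundary_top hT (hpos n) (n : ℝ)
  choose a ha1 ha2 using fun n : ℕ => boundary_bot hT (hpos n) (-(n : ℝ))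
  have hb : Tendsto b atTop atTop := tendsto_atTop_mono hb1 tendsto_natCast_atTop_atTop
  have ha : Tendsto a atTop atBot :=
    tendsto_atBot_mono ha1 (tendsto_neg_atTop_atBot.comp tendsto_natCast_atTop_atTop)
  have hlim : ∀ u : ℝ → ℝ, Integrable u →
      Tendsto (fun n => ∫ x in (a n)..(b n), u x) atTop (𝓝 (∫ x, u x)) := fun u hu =>
    intervalIntegral_tendsto_integral hu ha hb
  have hε : Tendsto (fun n : ℕ => 1 / ((n:ℝ) + 1)) atTop (𝓝 0) :=
    tendsto_one_div_add_atTop_nhds_zero_nat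
  have L := hlim _ hE
  have R := (((hlim _ hJ).const_mul (1/2)).sub
    ((hlim _ hmi).const_mul (1 + (1/2) * Real.log (2 * Real.pi)))).add (hε.add hε)
  have := le_of_tendsto_of_tendsto' L R fun n => by
    have hab : a n ≤ b n := by
      have := ha1 n; have := hb1 n; have : (0:ℝ) ≤ n := by positivity
      linarith
    have := lsi_trunc hmc hmpos hh hac hJ hE hT hab
    have := hb2 n; have := ha2 n
    linarith
  rw [hm1] at this
  linarith

/-- The tensorization step: integrate out the last variables. -/
lemma lsi_step {d : ℕ} {G D : ℝ × (Fin d → ℝ) → ℝ} {K : ℝ → ℝ}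
    (hGpos : ∀ p, 0 < G p) (hDc : Continuous D)
    (hGD : ∀ x y, HasDerivAt (fun x => G (x, y)) (D (x, y)) x)
    (hG : Integrable G) (hG1 : ∫ p, G p = 1)
    (hJ : Integrable (fun p => D p ^ 2 / G p))
    (hE : Integrable (fun p => G p * Real.log (G p)))
    (hK : Integrable K)
    (hKle : ∀ᵐ x, (∫ y, G (x, y) * Real.log (G (x, y)))
      - (∫ y, G (x, y)) * Real.log (∫ y, G (x, y)) ≤ K x) :
    (∫ p, G p * Real.log (G p)) ≤
      (1/2) * (∫ p, D p ^ 2 / G p) - (1 + (1/2) * Real.log (2 * Real.pi)) + ∫ x, K x := by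
  have hD : Integrable D := by
    refine (hG.add hJ).mono' hDc.aestronglyMeasurable (Eventually.of_forall fun p => ?_)
    have h1 := hGpos p
    have h2 : G p + D p ^ 2 / G p - |D p| = ((G p - |D p| / 2) ^ 2 + (3/4) * |D p| ^ 2) / G p := by
      rw [← sq_abs (D p)]; field_simp; ring
    have h3 : 0 ≤ ((G p - |D p| / 2) ^ 2 + (3/4) * |D p| ^ 2) / G p := by positivity
    rw [Real.norm_eq_abs]; simp only [Pi.add_apply]; linarith
  rw [Measure.volume_eq_prod] at hG hJ hE hD hG1 ⊢
  set m0 : ℝ → ℝ := fun x => ∫ y, G (x, y) with hm0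
  set h : ℝ → ℝ := fun x => ∫ y, D (x, y) with hhdef
  have hm0i : Integrable m0 := hG.integral_prod_left
  have hhi : Integrable h := hD.integral_prod_left
  have hsl := hG.prod_right_ae
  have hslD := hD.prod_right_ae
  have hslJ := hJ.prod_right_ae
  have hFTC : ∀ a x, Integrable (fun y => G (a, y)) → Integrable (fun y => G (x, y)) →
      m0 x - m0 a = ∫ t in a..x, h t := by
    intro a x ha hx
    have e1 : ∀ y, G (x, y) - G (a, y) = ∫ t in a..x, D (t, y) := fun y => by
      rw [intervalIntegral.integral_eq_sub_of_hasDerivAt (fun t _ => hGD t y)]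
      exact (hDc.comp (by fun_prop : Continuous fun t : ℝ => (t, y))).intervalIntegrable _ _
    simp only [hm0, hhdef]
    rw [← integral_sub hx ha, intervalIntegral_integral_swap]
    · exact integral_congr_ae (Eventually.of_forall e1)
    · exact hD.mono_measure (Measure.prod_mono Measure.restrict_le_self le_rfl)
  obtain ⟨a0, ha0⟩ := hsl.exists
  set m : ℝ → ℝ := fun x => m0 a0 + ∫ t in a0..x, h t with hm
  have hmm0 : m =ᵐ[volume] m0 := by
    filter_upwards [hsl] with x hx
    simp only [hm]; rw [← hFTC a0 x ha0 hx]; ring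
  have hmc : Continuous m := by
    exact continuous_const.add (intervalIntegral.continuous_primitive
      (fun _ _ => hhi.intervalIntegrable) a0)
  have hm0pos : ∀ᵐ x, 0 < m0 x := by
    filter_upwards [hsl] with x hx
    simp only [hm0]
    rw [integral_pos_iff_support_of_nonneg (fun y => (hGpos _).le) hx]
    have : Function.support (fun y => G (x, y)) = univ := by
      ext y; simp [(hGpos (x, y)).ne']
    rw [this]; exact isOpen_univ.measure_pos _ univ_nonempty
  have hmpos : ∀ᵐ x, 0 < m x := by
    filter_upwards [hmm0, hm0pos] with x h1 h2; rw [h1]; exact h2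
  have hmi : Integrable m := hm0i.congr hmm0.symm
  have hm1 : ∫ x, m x = 1 := by
    rw [integral_congr_ae hmm0, ← hG1, integral_prod _ hG]
  have hac : ∀ a b, m b - m a = ∫ x in a..b, h x := fun a b => by
    simp only [hm]
    rw [← intervalIntegral.integral_add_adjacent_intervals
      (hhi.intervalIntegrable (a := a0) (b := a)) (hhi.intervalIntegrable (a := a) (b := b))]
    ring
  -- Fisher information decreases under marginalization
  set I0 : ℝ → ℝ := fun x => ∫ y, D (x, y) ^ 2 / G (x, y) with hI0
  have hI0i : Integrable I0 := hJ.integral_prod_left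
  have hfish : ∀ᵐ x, h x ^ 2 / m x ≤ I0 x := by
    filter_upwards [hsl, hslD, hslJ, hmm0, hm0pos] with x h1 h2 h3 h4 h5
    rw [h4]
    set l := h x / m0 x with hl
    have e : 2 * l * h x - l ^ 2 * m0 x ≤ I0 x := by
      simp only [hhdef, hm0, hI0]
      rw [← integral_const_mul, ← integral_const_mul,
        ← integral_sub (h2.const_mul _) (h1.const_mul _)]
      refine integral_mono ((h2.const_mul _).sub (h1.const_mul _)) h3 fun y => ?_
      have hg := hGpos (x, y)
      have : D (x, y) ^ 2 / G (x, y) - (2 * l * D (x, y) - l ^ 2 * G (x, y))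
        = (D (x, y) - l * G (x, y)) ^ 2 / G (x, y) := by field_simp; ring
      have h0 : 0 ≤ (D (x, y) - l * G (x, y)) ^ 2 / G (x, y) := by positivity
      show 2 * l * D (x, y) - l ^ 2 * G (x, y) ≤ D (x, y) ^ 2 / G (x, y)
      linarith
    have e2 : 2 * l * h x - l ^ 2 * m0 x = h x ^ 2 / m0 x := by
      rw [hl]; field_simp; ring
    linarith
  have hJm : Integrable (fun x => h x ^ 2 / m x) := by
    refine hI0i.mono' ?_ ?_
    · exact (hhi.aestronglyMeasurable.pow 2).div₀ hmc.aestronglyMeasurable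
    · filter_upwards [hfish, hmpos] with x h1 h2
      rw [Real.norm_of_nonneg (by positivity)]; exact h1
  -- entropy of the marginal
  set S : ℝ → ℝ := fun x => ∫ y, G (x, y) * Real.log (G (x, y)) with hS
  have hSi : Integrable S := hE.integral_prod_left
  set C : ℝ := |m0 a0| + (∫ x, |h x|) + 1 with hC
  have hint0 : 0 ≤ ∫ x, |h x| := integral_nonneg fun x => abs_nonneg _
  have hC1 : 1 ≤ C := by have := abs_nonneg (m0 a0); linarith
  have hmC : ∀ x, m x ≤ C := fun x => by
    have h1 : |∫ t in a0..x, h t| ≤ ∫ x, |h x| := by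
      rw [← Real.norm_eq_abs]
      refine (intervalIntegral.norm_integral_le_integral_norm_uIoc).trans ?_
      exact setIntegral_le_integral hhi.norm (Eventually.of_forall fun x => norm_nonneg _)
    have h2 := le_abs_self (m0 a0)
    have h3 := le_abs_self (∫ t in a0..x, h t)
    simp only [hm]; linarith
  have hEm : Integrable (fun x => m x * Real.log (m x)) := by
    refine ((hSi.sub hK).norm.add (hmi.mul_const (Real.log C))).mono' ?_ ?_
    · exact (hmc.measurable.mul (Real.measurable_log.comp hmc.measurable)).aestronglyMeasurable
    · filter_upwards [hKle, hmm0, hmpos] with x h1 h2 h3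
      have h4 : Real.log (m x) ≤ Real.log C := Real.log_le_log h3 (hmC x)
      have h5 := mul_le_mul_of_nonneg_left h4 h3.le
      have h6 : 0 ≤ m x * Real.log C := mul_nonneg h3.le (Real.log_nonneg hC1)
      have h7 : S x - m x * Real.log (m x) ≤ K x := by rw [h2]; exact h1
      show |m x * Real.log (m x)| ≤ |S x - K x| + m x * Real.log C
      rw [abs_le]
      have := neg_abs_le (S x - K x); have := le_abs_self (S x - K x)
      have := abs_nonneg (S x - K x)
      constructor <;> linarith
  have main := lsi_one hmc hmpos hmi hm1 hhi hac hJm hEm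
  have f1 : ∫ x, h x ^ 2 / m x ≤ ∫ x, I0 x := integral_mono_ae hJm hI0i hfish
  have f2 : ∫ p, D p ^ 2 / G p ∂(volume.prod volume) = ∫ x, I0 x := integral_prod _ hJ
  have f3 : ∫ p, G p * Real.log (G p) ∂(volume.prod volume) = ∫ x, S x := integral_prod _ hE
  have f4 : ∫ x, S x ≤ ∫ x, (m x * Real.log (m x) + K x) := by
    refine integral_mono_ae hSi (hEm.add hK) ?_
    filter_upwards [hKle, hmm0] with x h1 h2
    have h7 : S x - m x * Real.log (m x) ≤ K x := by rw [h2]; exact h1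
    show S x ≤ m x * Real.log (m x) + K x
    linarith
  rw [integral_add hEm hK] at f4
  rw [f2, f3]
  linarith

/-- The linearized Euclidean LSI in dimension `d`. -/
def LinLSI (d : ℕ) : Prop :=
  ∀ f : (Fin d → ℝ) → ℝ, ContDiff ℝ 1 f → (∀ x, 0 < f x) → Integrable f → (∫ x, f x) = 1 →
    Integrable (fun x => f x * Real.log (f x)) →
    (∀ i, Integrable (fun x => pder d f i x ^ 2 / f x)) →
    (∫ x, f x * Real.log (f x)) ≤ (∑ i, (1/2) * ∫ x, pder d f i x ^ 2 / f x)
      - d * (1 + (1/2) * Real.log (2 * Real.pi))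

lemma LinLSI.hom {d : ℕ} (H : LinLSI d) {f : (Fin d → ℝ) → ℝ} (hf : ContDiff ℝ 1 f)
    (hpos : ∀ x, 0 < f x) (hi : Integrable f)
    (hE : Integrable (fun x => f x * Real.log (f x)))
    (hJ : ∀ i, Integrable (fun x => pder d f i x ^ 2 / f x)) :
    (∫ x, f x * Real.log (f x)) - (∫ x, f x) * Real.log (∫ x, f x) ≤
      (∑ i, (1/2) * ∫ x, pder d f i x ^ 2 / f x)
      - d * (1 + (1/2) * Real.log (2 * Real.pi)) * ∫ x, f x := by
  have hM : 0 < ∫ x, f x := by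
    rw [integral_pos_iff_support_of_nonneg (fun y => (hpos _).le) hi]
    have : Function.support f = univ := by
      ext y; simp [(hpos y).ne']
    rw [this]; exact isOpen_univ.measure_pos _ univ_nonempty
  set M := ∫ x, f x with hMdef
  have e1 : ∀ x, (M⁻¹ * f x) * Real.log (M⁻¹ * f x)
      = M⁻¹ * (f x * Real.log (f x)) - (M⁻¹ * Real.log M) * f x := fun x => by
    rw [Real.log_mul (by positivity) (hpos x).ne', Real.log_inv]; ring
  have e2 : ∀ i x, pder d (fun x => M⁻¹ * f x) i x ^ 2 / (M⁻¹ * f x)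
      = M⁻¹ * (pder d f i x ^ 2 / f x) := fun i x => by
    have : pder d (fun x => M⁻¹ * f x) i x = M⁻¹ * pder d f i x := by
      unfold pder
      rw [fderiv_const_mul ((hf.differentiable (by simp)) x)]; simp
    rw [this]
    have := hpos x
    field_simp
  have := H (fun x => M⁻¹ * f x) (contDiff_const.mul hf) (fun x => by have := hpos x; positivity)
    (hi.const_mul _) (by rw [integral_const_mul, ← hMdef]; field_simp)
    (by simp_rw [e1]; exact (hE.const_mul _).sub (hi.const_mul _))
    (fun i => by simp_rw [e2]; exact (hJ i).const_mul _)
  simp_rw [e1, e2, integral_const_mul] at this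
  rw [integral_sub (hE.const_mul _) (hi.const_mul _), integral_const_mul, integral_const_mul,
    ← hMdef] at this
  have e3 : (∑ i, (1/2) * (M⁻¹ * ∫ x, pder d f i x ^ 2 / f x))
      = M⁻¹ * ∑ i, (1/2) * ∫ x, pder d f i x ^ 2 / f x := by
    rw [Finset.mul_sum]; exact Finset.sum_congr rfl fun i _ => by ring
  rw [e3] at this
  have h2 := mul_le_mul_of_nonneg_left this hM.le
  have e4 : ∀ A, M * (M⁻¹ * A) = A := fun A => by field_simp
  rw [mul_sub, mul_sub, e4, mul_assoc M⁻¹, e4, e4] at h2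
  linarith

lemma linLSI_zero : LinLSI 0 := by
  intro f _ _ _ h1 _ _
  have hv : ∀ g : (Fin 0 → ℝ) → ℝ, ∫ x, g x = g default := fun g => by
    have hvol : (volume : Measure (Fin 0 → ℝ)) = Measure.dirac default := by
      rw [volume_pi, Measure.pi_of_empty _ default]
    rw [hvol, integral_dirac]
  rw [hv] at h1 ⊢
  rw [h1]; simp

lemma pder_lineDeriv {d : ℕ} {f : (Fin d → ℝ) → ℝ} (hf : ContDiff ℝ 1 f) (i : Fin d)
    (x : Fin d → ℝ) : pder d f i x = lineDeriv ℝ f x (Pi.single i 1) :=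
  (((hf.differentiable (by simp)) x).lineDeriv_eq_fderiv).symm

lemma cons_contDiff {d : ℕ} : ContDiff ℝ 1
    (fun p : ℝ × (Fin d → ℝ) => (Fin.cons p.1 p.2 : Fin (d + 1) → ℝ)) := by
  rw [contDiff_pi]
  intro i
  refine Fin.cases ?_ (fun j => ?_) i
  · simpa using contDiff_fst
  · simp only [Fin.cons_succ]
    exact (contDiff_apply ℝ ℝ j).comp contDiff_snd

lemma pder_cont {d : ℕ} {f : (Fin d → ℝ) → ℝ} (hf : ContDiff ℝ 1 f) (i : Fin d) :
    Continuous (pder d f i) := by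
  unfold pder
  exact (hf.continuous_fderiv (by simp)).clm_apply continuous_const

lemma linLSI_succ {d : ℕ} (H : LinLSI d) : LinLSI (d + 1) := by
  intro f hf hpos hi h1 hE hJ
  set e := (MeasurableEquiv.piFinSuccAbove (fun _ : Fin (d + 1) => ℝ) 0).symm with he
  have hmp : MeasurePreserving e volume volume :=
    (volume_preserving_piFinSuccAbove (fun _ : Fin (d + 1) => ℝ) 0).symm
  have hec : ∀ p : ℝ × (Fin d → ℝ), e p = Fin.cons p.1 p.2 := fun p => by
    rw [he]; simp [MeasurableEquiv.piFinSuccAbove, Fin.insertNthEquiv]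
  have hprodInt : ∀ u : (Fin (d + 1) → ℝ) → ℝ, Integrable u →
      Integrable (fun p : ℝ × (Fin d → ℝ) => u (Fin.cons p.1 p.2)) := fun u hu => by
    have := (hmp.integrable_comp_emb e.measurableEmbedding (g := u)).2 hu
    refine this.congr (Eventually.of_forall fun p => ?_)
    simp only [Function.comp, hec]
  have heq : ∀ u : (Fin (d + 1) → ℝ) → ℝ,
      ∫ p : ℝ × (Fin d → ℝ), u (Fin.cons p.1 p.2) = ∫ x, u x := fun u => by
    rw [← hmp.integral_comp' u]; simp only [hec]
  have hcc := cons_contDiff (d := d)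
  have hslice : ∀ x : ℝ, ContDiff ℝ 1 (fun y : Fin d → ℝ => f (Fin.cons x y)) := fun x =>
    hf.comp (hcc.comp (contDiff_const.prodMk contDiff_id))
  have hpd : ∀ (x : ℝ) (i : Fin d) (y : Fin d → ℝ),
      pder d (fun y => f (Fin.cons x y)) i y = pder (d + 1) f i.succ (Fin.cons x y) := by
    intro x i y
    rw [pder_lineDeriv (hslice x), pder_lineDeriv hf]
    unfold lineDeriv
    refine congrArg (fun g => deriv g (0:ℝ)) (funext fun t => ?_)
    refine congrArg f (funext fun j => ?_)
    refine Fin.cases ?_ (fun k => ?_) j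
    · simp
    · simp [Pi.single_apply]
  have hi' := hprodInt _ hi
  have hE' := hprodInt _ hE
  have hJ' := fun i => hprodInt _ (hJ i)
  rw [Measure.volume_eq_prod] at hi' hE'
  have hJ'' : ∀ i : Fin d, Integrable (fun p : ℝ × (Fin d → ℝ) =>
      pder (d + 1) f i.succ (Fin.cons p.1 p.2) ^ 2 / f (Fin.cons p.1 p.2))
      (volume.prod volume) := fun i => hJ' i.succ
  set c := (1 + (1/2) * Real.log (2 * Real.pi)) with hc
  have key := lsi_step (d := d) (G := fun p => f (Fin.cons p.1 p.2))
    (D := fun p => pder (d + 1) f 0 (Fin.cons p.1 p.2))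
    (K := fun x => (∑ i : Fin d, (1/2) * ∫ y : Fin d → ℝ,
      pder (d + 1) f i.succ (Fin.cons x y) ^ 2 / f (Fin.cons x y))
      - d * c * ∫ y : Fin d → ℝ, f (Fin.cons x y))
    (fun p => hpos _) ((pder_cont hf 0).comp hcc.continuous)
    (fun x y => by
      have h1 : HasDerivAt (fun x : ℝ => (Fin.cons x y : Fin (d + 1) → ℝ)) (Pi.single 0 1) x := by
        rw [hasDerivAt_pi]
        intro j
        refine Fin.cases ?_ (fun k => ?_) j
        · simp only [Fin.cons_zero, Pi.single_eq_same]; exact hasDerivAt_id x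
        · simpa using hasDerivAt_const x (y k)
      exact ((hf.differentiable (by simp)) _).hasFDerivAt.comp_hasDerivAt x h1)
    (hprodInt _ hi) (by rw [heq, h1]) (hJ' 0) (hprodInt _ hE)
    (Integrable.sub (integrable_finsetSum _ fun i _ => ((hJ'' i).integral_prod_left).const_mul _)
      (hi'.integral_prod_left.const_mul _))
    (by
      have hall : ∀ᵐ x : ℝ, ∀ i : Fin d, Integrable (fun y : Fin d → ℝ =>
        pder (d + 1) f i.succ (Fin.cons x y) ^ 2 / f (Fin.cons x y)) :=
        ae_all_iff.2 fun i => (hJ'' i).prod_right_ae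
      filter_upwards [hall, hi'.prod_right_ae, hE'.prod_right_ae] with x a1 a2 a3
      have := H.hom (hslice x) (fun y => hpos _) a2 a3 (fun i => by simp_rw [hpd]; exact a1 i)
      simp_rw [hpd] at this
      exact this)
  rw [heq (fun x => f x * Real.log (f x)), heq (fun x => pder (d + 1) f 0 x ^ 2 / f x),
    integral_sub (integrable_finsetSum _ fun i _ => ((hJ'' i).integral_prod_left).const_mul _)
      (hi'.integral_prod_left.const_mul _), integral_const_mul,
    integral_finsetSum _ (fun i _ => ((hJ'' i).integral_prod_left).const_mul _)] at key
  simp_rw [integral_const_mul] at key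
  have g1 : ∫ x : ℝ, ∫ y : Fin d → ℝ, f (Fin.cons x y) = 1 := by
    rw [← h1, ← heq f, Measure.volume_eq_prod, integral_prod _ hi']
  have g2 : ∀ i : Fin d, ∫ x : ℝ, ∫ y : Fin d → ℝ,
      pder (d + 1) f i.succ (Fin.cons x y) ^ 2 / f (Fin.cons x y)
      = ∫ x, pder (d + 1) f i.succ x ^ 2 / f x := fun i => by
    rw [← heq (fun x => pder (d + 1) f i.succ x ^ 2 / f x), Measure.volume_eq_prod,
      integral_prod _ (hJ'' i)]
  simp_rw [g2] at key
  rw [g1] at key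
  rw [Fin.sum_univ_succ]
  push_cast
  linarith

lemma linLSI (d : ℕ) : LinLSI d := by
  induction d with
  | zero => exact linLSI_zero
  | succ d ih => exact linLSI_succ ih

open scoped MatrixOrder in
lemma exists_whitening {d : ℕ} {J : Matrix (Fin d) (Fin d) ℝ} (hJ : J.PosDef) :
    ∃ A : Matrix (Fin d) (Fin d) ℝ, A.det ≠ 0 ∧ Aᵀ * J * A = 1 ∧
      Real.log |A.det| = -(1/2) * Real.log J.det := by
  obtain ⟨B, hB⟩ := CStarAlgebra.nonneg_iff_eq_star_mul_self.mp hJ.posSemidef.nonneg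
  have hB' : J = Bᵀ * B := by
    rw [hB, Matrix.star_eq_conjTranspose, Matrix.conjTranspose_eq_transpose_of_trivial]
  have hdet : J.det = B.det * B.det := by rw [hB', Matrix.det_mul, Matrix.det_transpose]
  have hBd : B.det ≠ 0 := fun h => by
    have := hJ.det_pos; rw [hdet, h] at this; simp at this
  have hu : IsUnit B.det := isUnit_iff_ne_zero.2 hBd
  refine ⟨B⁻¹, ?_, ?_, ?_⟩
  · rw [Matrix.det_nonsing_inv, Ring.inverse_eq_inv']; exact inv_ne_zero hBd
  · have h1 : (B⁻¹)ᵀ * Bᵀ = 1 := by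
      rw [← Matrix.transpose_mul, Matrix.mul_nonsing_inv B hu, Matrix.transpose_one]
    rw [hB', ← Matrix.mul_assoc, h1, Matrix.one_mul, Matrix.mul_nonsing_inv B hu]
  · rw [Matrix.det_nonsing_inv, Ring.inverse_eq_inv', abs_inv, Real.log_inv, Real.log_abs, hdet,
      Real.log_mul hBd hBd]; ring

lemma mulVec_emb {d : ℕ} {A : Matrix (Fin d) (Fin d) ℝ} (hA : A.det ≠ 0) :
    MeasurableEmbedding (fun x : Fin d → ℝ => A *ᵥ x) :=
  Continuous.measurableEmbedding ((Matrix.toLin' A).toContinuousLinearMap.continuous)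
    (Matrix.mulVec_injective_of_isUnit
      ((Matrix.isUnit_iff_isUnit_det A).2 (isUnit_iff_ne_zero.2 hA)))

lemma map_mulVec {d : ℕ} {A : Matrix (Fin d) (Fin d) ℝ} (hA : A.det ≠ 0) :
    Measure.map (fun x : Fin d → ℝ => A *ᵥ x) volume = ENNReal.ofReal |A.det⁻¹| • volume :=
  Real.map_matrix_volume_pi_eq_smul_volume_pi hA

lemma cov_integral {d : ℕ} {A : Matrix (Fin d) (Fin d) ℝ} (hA : A.det ≠ 0)
    (u : (Fin d → ℝ) → ℝ) : ∫ x, |A.det| * u (A *ᵥ x) = ∫ y, u y := by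
  rw [integral_const_mul, ← (mulVec_emb hA).integral_map u, map_mulVec hA, integral_smul_measure,
    ENNReal.toReal_ofReal (abs_nonneg _), smul_eq_mul, ← mul_assoc, ← abs_mul,
    mul_inv_cancel₀ hA]
  simp

lemma cov_integrable {d : ℕ} {A : Matrix (Fin d) (Fin d) ℝ} (hA : A.det ≠ 0)
    {u : (Fin d → ℝ) → ℝ} (hu : Integrable u) : Integrable (fun x => |A.det| * u (A *ᵥ x)) := by
  refine Integrable.const_mul ?_ _
  have := (mulVec_emb hA).integrable_map_iff (μ := volume) (g := u)
  refine this.1 ?_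
  rw [map_mulVec hA]
  exact hu.smul_measure ENNReal.ofReal_ne_top

/-- Dimensional Euclidean logarithmic Sobolev inequality (Dembo's form): for a smooth
probability density `f` on `ℝ^d` with positive definite Fisher information matrix `J(f)`,
`∫ f ln f dx ≤ (1/2) ln det J(f) − (d/2) ln(2πe)`. -/
theorem dimensional_euclidean_lsi (d : ℕ) (f : (Fin d → ℝ) → ℝ)
    (hsmooth : ContDiff ℝ (⊤ : ℕ∞) f) (hpos : ∀ x, 0 < f x)
    (hnorm : (∫ x : Fin d → ℝ, f x) = 1)
    (hent : Integrable (fun x : Fin d → ℝ => f x * Real.log (f x)))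
    (hJint : ∀ i j : Fin d, Integrable (fun x : Fin d → ℝ => pder d f i x * pder d f j x / f x))
    (hJ : (fisherMat d f).PosDef) :
    (∫ x : Fin d → ℝ, f x * Real.log (f x))
      ≤ (1 / 2) * Real.log (fisherMat d f).det
        - ((d : ℝ) / 2) * Real.log (2 * Real.pi * Real.exp 1) := by
  obtain ⟨A, hA0, hAJ, hAdet⟩ := exists_whitening hJ
  have hf1 : ContDiff ℝ 1 f := hsmooth.of_le (by exact_mod_cast le_top)
  have hfi : Integrable f := by
    by_contra hcon
    rw [integral_undef hcon] at hnorm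
    exact zero_ne_one hnorm
  set c := |A.det| with hc
  have hc0 : 0 < c := abs_pos.2 hA0
  have hlin : ContDiff ℝ 1 (fun x : Fin d → ℝ => A *ᵥ x) :=
    ((Matrix.toLin' A).toContinuousLinearMap).contDiff
  have hFA : ContDiff ℝ 1 (fun x => f (A *ᵥ x)) := hf1.comp hlin
  have hpd : ∀ i x, pder d (fun x => c * f (A *ᵥ x)) i x
      = c * ∑ k, A k i * pder d f k (A *ᵥ x) := by
    intro i x
    unfold pder
    rw [fderiv_const_mul ((hFA.differentiable (by simp)) x)]
    have h1 : HasFDerivAt (fun x => f (A *ᵥ x))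
        ((fderiv ℝ f (A *ᵥ x)).comp ((Matrix.toLin' A).toContinuousLinearMap)) x :=
      ((hf1.differentiable (by simp)) (A *ᵥ x)).hasFDerivAt.comp x
        ((Matrix.toLin' A).toContinuousLinearMap).hasFDerivAt
    rw [h1.fderiv]
    have h2 : A *ᵥ (Pi.single i 1) = ∑ k, A k i • (Pi.single k 1 : Fin d → ℝ) := by
      ext j
      simp [Finset.sum_apply, Pi.single_apply]
    have h3 : (fderiv ℝ f (A *ᵥ x)) (A *ᵥ (Pi.single i 1))
        = ∑ k, A k i * (fderiv ℝ f (A *ᵥ x)) (Pi.single k 1) := by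
      rw [h2, map_sum]; simp
    simpa using Or.inl h3
  have hquad : ∀ i x, pder d (fun x => c * f (A *ᵥ x)) i x ^ 2 / (c * f (A *ᵥ x))
      = c * ∑ k, ∑ l, A k i * A l i *
        (pder d f k (A *ᵥ x) * pder d f l (A *ᵥ x) / f (A *ᵥ x)) := by
    intro i x
    have h0 := hpos (A *ᵥ x)
    rw [hpd, mul_pow, sq (∑ k, _), Finset.sum_mul_sum]
    have : c ^ 2 * (∑ k, ∑ l, A k i * pder d f k (A *ᵥ x) * (A l i * pder d f l (A *ᵥ x)))
        / (c * f (A *ᵥ x)) = c * ((∑ k, ∑ l, A k i * pder d f k (A *ᵥ x) *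
          (A l i * pder d f l (A *ᵥ x))) / f (A *ᵥ x)) := by field_simp
    rw [this, Finset.sum_div]
    congr 1
    refine Finset.sum_congr rfl fun k _ => ?_
    rw [Finset.sum_div]
    exact Finset.sum_congr rfl fun l _ => by ring
  have hlog : ∀ x, c * f (A *ᵥ x) * Real.log (c * f (A *ᵥ x))
      = c * (f (A *ᵥ x) * Real.log (f (A *ᵥ x)) + Real.log c * f (A *ᵥ x)) := fun x => by
    rw [Real.log_mul hc0.ne' (hpos _).ne']; ring
  have hquadi : ∀ i : Fin d, Integrable (fun y => ∑ k, ∑ l, A k i * A l i *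
        (pder d f k y * pder d f l y / f y)) := fun i =>
    integrable_finsetSum _ fun k _ => integrable_finsetSum _ fun l _ => (hJint k l).const_mul _
  have hquadv : ∀ i : Fin d, ∫ y, (∑ k, ∑ l, A k i * A l i *
        (pder d f k y * pder d f l y / f y)) = 1 := fun i => by
    rw [integral_finsetSum _ fun k _ => integrable_finsetSum _ fun l _ =>
      (hJint k l).const_mul _]
    simp_rw [integral_finsetSum _ fun l _ => (hJint _ l).const_mul _, integral_const_mul]
    have h1 : (Aᵀ * fisherMat d f * A) i i = 1 := by rw [hAJ]; simp
    rw [← h1]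
    simp only [Matrix.mul_apply, Matrix.transpose_apply, Finset.sum_mul]
    rw [Finset.sum_comm]
    refine Finset.sum_congr rfl fun k _ => Finset.sum_congr rfl fun l _ => ?_
    simp only [fisherMat, Matrix.of_apply]; ring
  have hEi : Integrable (fun y => f y * Real.log (f y) + Real.log c * f y) :=
    hent.add (hfi.const_mul _)
  have key := linLSI d (fun x => c * f (A *ᵥ x)) (contDiff_const.mul hFA)
    (fun x => mul_pos hc0 (hpos _)) (cov_integrable hA0 hfi)
    (by rw [cov_integral hA0 f, hnorm])
    (by simp_rw [hlog]; exact cov_integrable hA0 hEi)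
    (fun i => by simp_rw [hquad]; exact cov_integrable hA0 (hquadi i))
  simp_rw [hlog, hquad] at key
  rw [cov_integral hA0 (fun y => f y * Real.log (f y) + Real.log c * f y),
    integral_add hent (hfi.const_mul _), integral_const_mul, hnorm] at key
  have hs : ∀ i : Fin d, ∫ x, c * (∑ k, ∑ l, A k i * A l i *
        (pder d f k (A *ᵥ x) * pder d f l (A *ᵥ x) / f (A *ᵥ x))) = 1 := fun i => by
    rw [← hquadv i]
    exact cov_integral hA0 (fun y => ∑ k, ∑ l, A k i * A l i *
        (pder d f k y * pder d f l y / f y))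
  simp_rw [hs] at key
  simp only [Finset.sum_const, Finset.card_univ, Fintype.card_fin, nsmul_eq_mul] at key
  rw [Real.log_mul (by positivity) (by positivity), Real.log_exp]
  rw [hAdet] at key
  linarith
end

section
/- Data-free majorant via Jensen: suppose for each y the bound D_KL(π^y || π̃^y(V_r)) ≤ (1/2)[trace(V_⊥^T M^y V_⊥) − (d−r) + ln det(V_⊥^T(2I_d + H^y − M^y)V_⊥)] holds, where M^y, H^y are symmetric-matrix-valued measurable functions of y with E_Y[M^Y] = I_d and E_Y[H^Y] = H_df. Then E_Y[D_KL(π^Y || π̃^Y(V_r))] ≤ (1/2) ln det(V_⊥^T (I_d + H_df) V_⊥). -/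
open Matrix MeasureTheory

lemma log_det_le_trace {n : ℕ} {C : Matrix (Fin n) (Fin n) ℝ} (hC : C.PosDef) :
    Real.log C.det ≤ C.trace - n := by
  have h1 : C.det = ∏ i, hC.1.eigenvalues i := by
    simpa using hC.1.det_eq_prod_eigenvalues
  have h2 : C.trace = ∑ i, hC.1.eigenvalues i := by
    simpa using hC.1.trace_eq_sum_eigenvalues
  rw [h1, h2, Real.log_prod (fun i _ => (hC.eigenvalues_pos i).ne')]
  calc ∑ i, Real.log (hC.1.eigenvalues i) ≤ ∑ i, (hC.1.eigenvalues i - 1) :=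
        Finset.sum_le_sum fun i _ => Real.log_le_sub_one_of_pos (hC.eigenvalues_pos i)
    _ = _ := by simp

open scoped MatrixOrder Matrix.Norms.L2Operator in
lemma log_det_tangent {n : ℕ} {A B : Matrix (Fin n) (Fin n) ℝ} (hA : A.PosDef) (hB : B.PosDef) :
    Real.log A.det ≤ Real.log B.det + (B⁻¹ * A).trace - n := by
  obtain ⟨L, hL, hBL⟩ : ∃ L : Matrix (Fin n) (Fin n) ℝ, IsUnit L ∧ B⁻¹ = L * Lᴴ := by
    obtain ⟨K, hK⟩ := CStarAlgebra.nonneg_iff_eq_star_mul_self.mp hB.inv.posSemidef.nonneg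
    rw [Matrix.star_eq_conjTranspose] at hK
    refine ⟨Kᴴ, ?_, by simpa using hK⟩
    have hu : IsUnit (B⁻¹) := hB.inv.isUnit
    rw [Matrix.isUnit_iff_isUnit_det] at hu ⊢
    rw [hK, det_mul] at hu
    exact isUnit_of_mul_isUnit_left hu
  have hC : (Lᴴ * A * L).PosDef :=
    hA.conjTranspose_mul_mul_same (Matrix.mulVec_injective_of_isUnit hL)
  have h := log_det_le_trace hC
  have hdet : (Lᴴ * A * L).det = A.det * (B.det)⁻¹ := by
    have : (B⁻¹).det = (B.det)⁻¹ := by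
      rw [Matrix.det_nonsing_inv, Ring.inverse_eq_inv']
    rw [← this, hBL]
    simp only [det_mul]
    ring
  have htr : (Lᴴ * A * L).trace = (B⁻¹ * A).trace := by
    rw [hBL, Matrix.trace_mul_comm, Matrix.mul_assoc]
  rw [hdet, htr, Real.log_mul hA.det_pos.ne' (inv_ne_zero hB.det_pos.ne'), Real.log_inv] at h
  linarith

lemma integrable_trace_mul {Y : Type*} [MeasurableSpace Y] {ρ : Measure Y} {d : ℕ}
    (Q : Matrix (Fin d) (Fin d) ℝ) {X : Y → Matrix (Fin d) (Fin d) ℝ}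
    (hX : ∀ i j, Integrable (fun y => X y i j) ρ) :
    Integrable (fun y => (Q * X y).trace) ρ := by
  simp only [Matrix.trace, Matrix.diag, Matrix.mul_apply]
  exact integrable_finsetSum _ fun i _ => integrable_finsetSum _ fun j _ => (hX j i).const_mul _

lemma integral_trace_mul {Y : Type*} [MeasurableSpace Y] {ρ : Measure Y} {d : ℕ}
    (Q : Matrix (Fin d) (Fin d) ℝ) {X : Y → Matrix (Fin d) (Fin d) ℝ}
    (hX : ∀ i j, Integrable (fun y => X y i j) ρ) {Z : Matrix (Fin d) (Fin d) ℝ}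
    (hZ : ∀ i j, (∫ y, X y i j ∂ρ) = Z i j) :
    (∫ y, (Q * X y).trace ∂ρ) = (Q * Z).trace := by
  simp only [Matrix.trace, Matrix.diag, Matrix.mul_apply]
  rw [integral_finsetSum Finset.univ fun i _ =>
    integrable_finsetSum Finset.univ fun j _ => (hX j i).const_mul (Q i j)]
  refine Finset.sum_congr rfl fun i _ => ?_
  rw [integral_finsetSum Finset.univ fun j _ => (hX j i).const_mul (Q i j)]
  refine Finset.sum_congr rfl fun j _ => ?_
  rw [integral_const_mul, hZ]

lemma posSemidef_integral {Y : Type*} [MeasurableSpace Y] {ρ : Measure Y} {d : ℕ}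
    {X : Y → Matrix (Fin d) (Fin d) ℝ} (hp : ∀ y, (X y).PosSemidef)
    (hX : ∀ i j, Integrable (fun y => X y i j) ρ) {Z : Matrix (Fin d) (Fin d) ℝ}
    (hZ : ∀ i j, (∫ y, X y i j ∂ρ) = Z i j) : Z.PosSemidef := by
  have key : ∀ (x : Fin d → ℝ) (W : Matrix (Fin d) (Fin d) ℝ),
      star x ⬝ᵥ (W *ᵥ x) = (vecMulVec x x * W).trace := by
    intro x W
    rw [Matrix.vecMulVec_mul, Matrix.trace_vecMulVec, dotProduct_comm x,
      ← Matrix.dotProduct_mulVec]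
    simp
  refine Matrix.PosSemidef.of_dotProduct_mulVec_nonneg ?_ ?_
  · ext i j
    simp only [conjTranspose_apply, star_trivial]
    rw [← hZ, ← hZ]
    congr 1
    ext y
    simpa using (hp y).1.apply i j
  · intro x
    rw [key, ← integral_trace_mul _ hX hZ]
    refine integral_nonneg fun y => ?_
    simp only [Pi.zero_apply]
    rw [← key]
    exact (hp y).dotProduct_mulVec_nonneg x

/-- Data-free majorant via Jensen's inequality for `ln det`: if for each `y` the per-data
dimensional-LSI bound holds with symmetric PSD matrices `M^y`, `H^y` satisfying
`E[M^Y] = I` and `E[H^Y] = H_df`, then the expected KL is bounded by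
`(1/2) ln det(V_⊥ᵀ (I + H_df) V_⊥)`. -/
theorem datafree_majorant_jensen
    {Y : Type*} [MeasurableSpace Y] (ρ : Measure Y) [IsProbabilityMeasure ρ]
    (d r : ℕ) (hr : r ≤ d)
    (Vr : Matrix (Fin d) (Fin r) ℝ) (Vp : Matrix (Fin d) (Fin (d - r)) ℝ)
    (hVr : Vrᵀ * Vr = 1) (hVp : Vpᵀ * Vp = 1) (hVrVp : Vrᵀ * Vp = 0)
    (hcomplete : Vr * Vrᵀ + Vp * Vpᵀ = 1)
    (D : Y → ℝ) (M H : Y → Matrix (Fin d) (Fin d) ℝ)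
    (Hdf : Matrix (Fin d) (Fin d) ℝ)
    (hMpsd : ∀ y, (M y).PosSemidef) (hHpsd : ∀ y, (H y).PosSemidef)
    (hPD : ∀ y, (Vpᵀ * ((2 : ℝ) • (1 : Matrix (Fin d) (Fin d) ℝ) + H y - M y) * Vp).PosDef)
    (hDint : Integrable D ρ)
    (hMint : ∀ i j, Integrable (fun y => M y i j) ρ)
    (hHint : ∀ i j, Integrable (fun y => H y i j) ρ)
    (hEM : ∀ i j, (∫ y, M y i j ∂ρ) = (1 : Matrix (Fin d) (Fin d) ℝ) i j)
    (hEH : ∀ i j, (∫ y, H y i j ∂ρ) = Hdf i j)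
    (hbound : ∀ y, D y ≤ (1 / 2) * ((Vpᵀ * M y * Vp).trace - ((d : ℝ) - r)
      + Real.log ((Vpᵀ * ((2 : ℝ) • (1 : Matrix (Fin d) (Fin d) ℝ) + H y - M y) * Vp).det))) :
    (∫ y, D y ∂ρ) ≤ (1 / 2) * Real.log ((Vpᵀ * (1 + Hdf) * Vp).det) := by
  set B := Vpᵀ * (1 + Hdf) * Vp with hBdef
  have hB : B.PosDef := by
    have h1 : B = 1 + Vpᴴ * Hdf * Vp := by
      rw [hBdef, Matrix.mul_add, Matrix.add_mul, Matrix.mul_one, hVp,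
        Matrix.conjTranspose_eq_transpose_of_trivial]
    rw [h1]
    exact Matrix.PosDef.one.add_posSemidef
      ((posSemidef_integral hHpsd hHint hEH).conjTranspose_mul_mul_same Vp)
  have hcast : ((d - r : ℕ) : ℝ) = (d : ℝ) - r := Nat.cast_sub hr
  have htr : ∀ (P : Matrix (Fin (d - r)) (Fin (d - r)) ℝ) (X : Matrix (Fin d) (Fin d) ℝ),
      (P * (Vpᵀ * X * Vp)).trace = (Vp * P * Vpᵀ * X).trace := by
    intro P X
    rw [← Matrix.mul_assoc, Matrix.trace_mul_comm]
    simp only [Matrix.mul_assoc]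
  set Q1 := Vp * (1 : Matrix (Fin (d - r)) (Fin (d - r)) ℝ) * Vpᵀ with hQ1
  set Q2 := Vp * B⁻¹ * Vpᵀ with hQ2
  have hle : ∀ y, D y ≤ (1 / 2) * ((Q1 * M y).trace + ((Q2 * H y).trace - (Q2 * M y).trace)
      + (2 * Q2.trace - 2 * ((d : ℝ) - r) + Real.log B.det)) := by
    intro y
    have h1 := hbound y
    have h2 := log_det_tangent (hPD y) hB
    rw [htr, ← hQ2, hcast] at h2
    have h3 : (Vpᵀ * M y * Vp).trace = (Q1 * M y).trace := by
      rw [hQ1, ← htr, Matrix.one_mul]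
    have h4 : (Q2 * ((2 : ℝ) • (1 : Matrix (Fin d) (Fin d) ℝ) + H y - M y)).trace
        = 2 * Q2.trace + (Q2 * H y).trace - (Q2 * M y).trace := by
      simp [Matrix.mul_add, Matrix.mul_sub]
    rw [h3] at h1
    rw [h4] at h2
    linarith
  have i1 := integrable_trace_mul (ρ := ρ) Q1 hMint
  have i2 := integrable_trace_mul (ρ := ρ) Q2 hMint
  have i3 := integrable_trace_mul (ρ := ρ) Q2 hHint
  have hsum := i1.add (i3.sub i2)
  have hint := integral_mono hDint
    ((hsum.add (integrable_const (2 * Q2.trace - 2 * ((d : ℝ) - r) + Real.log B.det))).const_mul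
      (1 / 2)) hle
  refine hint.trans (le_of_eq ?_)
  simp only [Pi.add_apply, Pi.sub_apply]
  rw [integral_const_mul, integral_add (by exact hsum) (integrable_const _),
    integral_add i1 (by exact i3.sub i2),
    integral_sub i3 i2, integral_trace_mul Q1 hMint hEM, integral_trace_mul Q2 hMint hEM,
    integral_trace_mul Q2 hHint hEH]
  have t1 : (Q1 * 1).trace = (d : ℝ) - r := by
    rw [hQ1, ← htr, Matrix.mul_one, hVp, Matrix.mul_one, Matrix.trace_one, Fintype.card_fin, hcast]
  have t2 : Q2.trace + (Q2 * Hdf).trace = (d : ℝ) - r := by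
    have : (Q2 * (1 + Hdf)).trace = (d : ℝ) - r := by
      rw [hQ2, ← htr, ← hBdef, Matrix.nonsing_inv_mul _ hB.det_pos.ne'.isUnit, Matrix.trace_one,
        Fintype.card_fin, hcast]
    rwa [Matrix.mul_add, Matrix.mul_one, Matrix.trace_add] at this
  rw [t1, Matrix.mul_one]
  simp only [integral_const, probReal_univ, smul_eq_mul, one_mul]
  linarith
end
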